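/- arXiv:1501.00251 — 2 statements merged into one kernel-verified Lean document; each statement's English description precedes it below -/
import Mathlib

section
/- Let β ∈ (1,2) and let λ ∈ ℂ be a zero of the entire function z ↦ E_{β,2}(−z), i.e. E_{β,2}(−λ) = 0. Then u(x) = x E_{β,2}(−λ x^β) is a nontrivial solution (u′(0) = 1, so u ≢ 0) of the fractional Sturm–Liouville eigenvalue problem with zero potential: −(D_0^β u)(x) = λ u(x) on (0,1) together with the homogeneous Dirichlet boundary conditions u(0) = 0 and u(1) = 0. -/
open scoped Real

/-- Two-parameter Mittag-Leffler function (complex argument). -/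
noncomputable def mlC (a b : ℝ) (z : ℂ) : ℂ :=
  ∑' k : ℕ, z ^ k / Complex.Gamma (((k : ℝ) * a + b : ℝ) : ℂ)

/-- Two-parameter Mittag-Leffler function (real argument). -/
noncomputable def mlR (a b : ℝ) (x : ℝ) : ℝ :=
  ∑' k : ℕ, x ^ k / Real.Gamma ((k : ℝ) * a + b)

/-- Wright function (real argument). -/
noncomputable def wrightR (p m : ℝ) (x : ℝ) : ℝ :=
  ∑' k : ℕ, x ^ k / ((k.factorial : ℝ) * Real.Gamma (p * (k : ℝ) + m))

/-- Djrbashian-Caputo fractional derivative of order `g ∈ (0,1)` (real-valued). -/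
noncomputable def caputoR (g : ℝ) (f : ℝ → ℝ) (t : ℝ) : ℝ :=
  (1 / Real.Gamma (1 - g)) * ∫ s in (0:ℝ)..t, (t - s) ^ (-g) * deriv f s

/-- Djrbashian-Caputo fractional derivative of order `b ∈ (1,2)` (complex-valued). -/
noncomputable def caputoC2 (b : ℝ) (f : ℝ → ℂ) (x : ℝ) : ℂ :=
  (1 / Complex.Gamma ((2 - b : ℝ) : ℂ)) *
    ∫ s in (0:ℝ)..x, (((x - s) ^ (1 - b) : ℝ) : ℂ) * deriv (deriv f) s

/-- Riemann–Liouville fractional derivative of order `b ∈ (1,2)` (complex-valued). -/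
noncomputable def rlC2 (b : ℝ) (f : ℝ → ℂ) (x : ℝ) : ℂ :=
  deriv (deriv (fun y : ℝ =>
    (1 / Complex.Gamma ((2 - b : ℝ) : ℂ)) *
      ∫ s in (0:ℝ)..y, (((y - s) ^ (1 - b) : ℝ) : ℂ) * f s)) x

/-- The eigenfunction of the Djrbashian-Caputo fractional Sturm-Liouville problem
with zero potential. -/
noncomputable def u11 (β : ℝ) (lam : ℂ) (x : ℝ) : ℂ :=
  (x : ℂ) * mlC β 2 (-lam * ((x ^ β : ℝ) : ℂ))

/-- The fractional power kernel `x ^ (a - 1) / Γ(a)`. -/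
noncomputable def gammaPow (a x : ℝ) : ℝ :=
  x ^ (a - 1) / Real.Gamma a

/-- The `k`-th term of the series of `x ^ (γ - 1) E_{β,γ}(-lam x ^ β)`. -/
noncomputable def mlTerm (β : ℝ) (lam : ℂ) (γ : ℝ) (k : ℕ) (x : ℝ) : ℂ :=
  (-lam) ^ k * ((gammaPow ((k : ℝ) * β + γ) x : ℝ) : ℂ)

theorem summable_pow_mul_abs_inv_Gamma {β γ : ℝ} (hβ : 1 ≤ β) (hγ : 0 ≤ γ) {r : ℝ} (hr : 0 ≤ r) :
    Summable fun k : ℕ => r ^ k * |(Real.Gamma ((k : ℝ) * β + γ))⁻¹| := by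
  rw [← summable_nat_add_iff 2]
  refine Summable.of_nonneg_of_le (fun k => by positivity) (fun k => ?_)
    ((Real.summable_pow_div_factorial r).mul_left (r ^ 2))
  have hk : (0 : ℝ) ≤ k := k.cast_nonneg
  have hle : (k : ℝ) + 1 + 1 ≤ ((k + 2 : ℕ) : ℝ) * β + γ := by push_cast; nlinarith
  have hΓ : ((k.factorial : ℕ) : ℝ) ≤ Real.Gamma (((k + 2 : ℕ) : ℝ) * β + γ) := by
    calc ((k.factorial : ℕ) : ℝ) ≤ ((k + 1).factorial : ℕ) := by
          exact_mod_cast Nat.factorial_le (Nat.le_succ k)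
      _ = Real.Gamma ((k : ℝ) + 1 + 1) := by
          rw [← Real.Gamma_nat_eq_factorial]; push_cast; rfl
      _ ≤ _ := Real.Gamma_strictMonoOn_Ici.monotoneOn
          (Set.mem_Ici.2 (by linarith)) (Set.mem_Ici.2 (by linarith)) hle
  have hf : (0 : ℝ) < (k.factorial : ℕ) := by exact_mod_cast k.factorial_pos
  rw [abs_of_pos (inv_pos.2 (hf.trans_le hΓ)), pow_add, mul_comm (r ^ k), mul_assoc,
    div_eq_mul_inv]
  gcongr

theorem abs_gammaPow_le {a x : ℝ} (ha : a = 0 ∨ 1 ≤ a) (hx : x ∈ Set.Icc (0 : ℝ) 1) :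
    |gammaPow a x| ≤ |(Real.Gamma a)⁻¹| := by
  rcases ha with rfl | ha
  · simp [gammaPow]
  · rw [gammaPow, div_eq_mul_inv, abs_mul, abs_of_nonneg (Real.rpow_nonneg hx.1 _)]
    exact mul_le_of_le_one_left (abs_nonneg _) (Real.rpow_le_one hx.1 hx.2 (by linarith))

theorem hasDerivAt_gammaPow {a x : ℝ} (ha : 1 ≤ a) (hx : 0 < x) :
    HasDerivAt (gammaPow a) (gammaPow (a - 1) x) x := by
  have h := (Real.hasDerivAt_rpow_const (p := a - 1) (Or.inl hx.ne')).div_const (Real.Gamma a)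
  refine h.congr_deriv ?_
  rcases ha.eq_or_lt with rfl | ha
  · simp [gammaPow]
  · have h1 : a - 1 ≠ 0 := by linarith
    have hΓ : Real.Gamma (a - 1) ≠ 0 := (Real.Gamma_pos_of_pos (by linarith)).ne'
    have := Real.Gamma_add_one h1
    rw [sub_add_cancel] at this
    rw [gammaPow, this]
    field_simp

theorem integral_rpow_mul_gammaPow {a b x : ℝ} (ha : 0 < a) (hb : 0 < b) (hx : 0 < x) :
    ∫ s in (0 : ℝ)..x, (((x - s) ^ (b - 1) : ℝ) : ℂ) * ((gammaPow a s : ℝ) : ℂ) =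
      Complex.Gamma (b : ℂ) * ((gammaPow (a + b) x : ℝ) : ℂ) := by
  have hΓa : (Real.Gamma a : ℂ) ≠ 0 := by exact_mod_cast (Real.Gamma_pos_of_pos ha).ne'
  have hΓab : (Real.Gamma (a + b) : ℂ) ≠ 0 := by
    exact_mod_cast (Real.Gamma_pos_of_pos (add_pos ha hb)).ne'
  have hbeta := Complex.Gamma_mul_Gamma_eq_betaIntegral (s := a) (t := b) (by simpa) (by simpa)
  have hcongr : Set.EqOn
      (fun s : ℝ => (((x - s) ^ (b - 1) : ℝ) : ℂ) * ((gammaPow a s : ℝ) : ℂ))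
      (fun s : ℝ => (Real.Gamma a : ℂ)⁻¹ *
        ((s : ℂ) ^ ((a : ℂ) - 1) * ((x : ℂ) - s) ^ ((b : ℂ) - 1)))
      (Set.uIoo 0 x) := by
    intro s hs
    rw [Set.uIoo_of_le hx.le] at hs
    simp only [gammaPow]
    rw [Complex.ofReal_div, Complex.ofReal_cpow hs.1.le, Complex.ofReal_cpow (sub_pos.2 hs.2).le]
    push_cast
    ring
  rw [intervalIntegral.integral_congr_uIoo hcongr, intervalIntegral.integral_const_mul,
    Complex.betaIntegral_scaled _ _ hx, gammaPow, Complex.ofReal_div, Complex.ofReal_cpow hx.le]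
  rw [← Complex.ofReal_add, Complex.Gamma_ofReal, Complex.Gamma_ofReal, Complex.Gamma_ofReal]
    at hbeta
  rw [Complex.Gamma_ofReal]
  push_cast
  field_simp
  linear_combination (-(x : ℂ) ^ ((a : ℂ) + b - 1)) * hbeta

section series

variable {β : ℝ} {lam : ℂ} {γ : ℝ}

theorem norm_mlTerm_le (hβ : 1 ≤ β) (hγ : γ = 0 ∨ 1 ≤ γ) (k : ℕ) {x : ℝ}
    (hx : x ∈ Set.Icc (0 : ℝ) 1) :
    ‖mlTerm β lam γ k x‖ ≤ ‖lam‖ ^ k * |(Real.Gamma ((k : ℝ) * β + γ))⁻¹| := by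
  rw [mlTerm, norm_mul, norm_pow, norm_neg, Complex.norm_real, Real.norm_eq_abs]
  refine mul_le_mul_of_nonneg_left (abs_gammaPow_le ?_ hx) (by positivity)
  rcases k.eq_zero_or_pos with rfl | hk
  · simpa using hγ
  · have hk' : (1 : ℝ) ≤ k := by exact_mod_cast hk
    right
    rcases hγ with rfl | hγ <;> nlinarith

theorem summable_mlTerm (hβ : 1 ≤ β) (hγ : γ = 0 ∨ 1 ≤ γ) {x : ℝ} (hx : x ∈ Set.Icc (0 : ℝ) 1) :
    Summable fun k => mlTerm β lam γ k x :=
  .of_norm_bounded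
    (summable_pow_mul_abs_inv_Gamma hβ (by rcases hγ with rfl | h <;> linarith) (norm_nonneg lam))
    fun k => norm_mlTerm_le hβ hγ k hx

theorem hasDerivAt_tsum_mlTerm (hβ : 1 ≤ β) (hγ : γ = 1 ∨ 2 ≤ γ) {x : ℝ}
    (hx : x ∈ Set.Ioo (0 : ℝ) 1) :
    HasDerivAt (fun y => ∑' k, mlTerm β lam γ k y) (∑' k, mlTerm β lam (γ - 1) k x) x := by
  have hγ1 : 1 ≤ γ := by rcases hγ with rfl | h <;> linarith
  have hγ' : γ - 1 = 0 ∨ 1 ≤ γ - 1 := hγ.imp (fun h => by linarith) (fun h => by linarith)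
  refine hasDerivAt_tsum_of_isPreconnected
    (summable_pow_mul_abs_inv_Gamma hβ (γ := γ - 1) (by linarith) (norm_nonneg lam))
    isOpen_Ioo isPreconnected_Ioo (fun k y hy => ?_)
    (fun k y hy => norm_mlTerm_le hβ hγ' k (Set.Ioo_subset_Icc_self hy)) hx
    (summable_mlTerm hβ (Or.inr hγ1) (Set.Ioo_subset_Icc_self hx)) hx
  have hk : (0 : ℝ) ≤ k * β := by positivity
  have h := (hasDerivAt_gammaPow (a := (k : ℝ) * β + γ) (by linarith) hy.1).ofReal_comp.const_mul
    ((-lam) ^ k)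
  rwa [add_sub_assoc] at h

theorem u11_eq_tsum_mlTerm {x : ℝ} (hx : 0 < x) :
    u11 β lam x = ∑' k, mlTerm β lam 2 k x := by
  rw [u11, mlC, ← tsum_mul_left]
  congr 1
  ext k
  have h : x ^ ((k : ℝ) * β + 2 - 1) = (x ^ β) ^ k * x := by
    rw [show (k : ℝ) * β + 2 - 1 = β * k + 1 by ring, Real.rpow_add hx, Real.rpow_one,
      Real.rpow_mul hx.le, Real.rpow_natCast]
  rw [mlTerm, gammaPow, h, Complex.Gamma_ofReal]
  push_cast
  ring

theorem deriv_deriv_u11 (hβ : 1 ≤ β) {x : ℝ} (hx : x ∈ Set.Ioo (0 : ℝ) 1) :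
    deriv (deriv (u11 β lam)) x = ∑' k, mlTerm β lam 0 k x := by
  have h1 : ∀ y ∈ Set.Ioo (0 : ℝ) 1, deriv (u11 β lam) y = ∑' k, mlTerm β lam 1 k y := by
    intro y hy
    have h := hasDerivAt_tsum_mlTerm (lam := lam) hβ (Or.inr le_rfl) hy
    rw [show (2 : ℝ) - 1 = 1 by norm_num] at h
    refine (h.congr_of_eventuallyEq ?_).deriv
    filter_upwards [isOpen_Ioo.mem_nhds hy] with z hz using u11_eq_tsum_mlTerm hz.1
  have h := hasDerivAt_tsum_mlTerm (lam := lam) hβ (Or.inl rfl) hx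
  rw [sub_self] at h
  refine (h.congr_of_eventuallyEq ?_).deriv
  filter_upwards [isOpen_Ioo.mem_nhds hx] with z hz using h1 z hz

theorem integral_rpow_mul_mlTerm_zero (k : ℕ) (hβ : β ∈ Set.Ioo (1 : ℝ) 2) {x : ℝ} (hx : 0 < x) :
    ∫ s in (0 : ℝ)..x, (((x - s) ^ (1 - β) : ℝ) : ℂ) * mlTerm β lam 0 (k + 1) s =
      Complex.Gamma ((2 - β : ℝ) : ℂ) * (-lam * mlTerm β lam 2 k x) := by
  have hpos : 0 < ((k + 1 : ℕ) : ℝ) * β + 0 := by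
    have := hβ.1
    positivity
  have h := integral_rpow_mul_gammaPow hpos (sub_pos.2 hβ.2) hx
  rw [show 2 - β - 1 = 1 - β by ring,
    show ((k + 1 : ℕ) : ℝ) * β + 0 + (2 - β) = (k : ℝ) * β + 2 by push_cast; ring] at h
  simp only [mlTerm, mul_left_comm _ ((-lam) ^ (k + 1))]
  rw [intervalIntegral.integral_const_mul, h]
  ring

theorem caputoC2_u11 (hβ : β ∈ Set.Ioo (1 : ℝ) 2) {x : ℝ} (hx : x ∈ Set.Ioo (0 : ℝ) 1) :
    caputoC2 β (u11 β lam) x = -lam * u11 β lam x := by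
  have hIoc : ∀ s ∈ Set.uIoc 0 x, s ∈ Set.Ioo (0 : ℝ) 1 := fun s hs => by
    rw [Set.uIoc_of_le hx.1.le] at hs
    exact ⟨hs.1, hs.2.trans_lt hx.2⟩
  have hsum := summable_pow_mul_abs_inv_Gamma hβ.1.le le_rfl (norm_nonneg lam)
  have hkernel : IntervalIntegrable (fun s : ℝ => (x - s) ^ (1 - β)) MeasureTheory.volume 0 x := by
    have h := (intervalIntegral.intervalIntegrable_rpow' (a := 0) (b := x) (r := 1 - β)
      (by linarith [hβ.2])).comp_sub_left x
    simpa using h.symm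
  have hint : HasSum
      (fun k => ∫ s in (0 : ℝ)..x, (((x - s) ^ (1 - β) : ℝ) : ℂ) * mlTerm β lam 0 k s)
      (∫ s in (0 : ℝ)..x, (((x - s) ^ (1 - β) : ℝ) : ℂ) * deriv (deriv (u11 β lam)) s) := by
    refine intervalIntegral.hasSum_integral_of_dominated_convergence
      (fun k s => (x - s) ^ (1 - β) * (‖lam‖ ^ k * |(Real.Gamma ((k : ℝ) * β + 0))⁻¹|))
      (fun k => ?_) (fun k => .of_forall fun s hs => ?_)
      (.of_forall fun s _ => hsum.mul_left _) ?_ (.of_forall fun s hs => ?_)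
    · unfold mlTerm gammaPow
      exact Measurable.aestronglyMeasurable (by fun_prop)
    · have hs' := hs
      rw [Set.uIoc_of_le hx.1.le] at hs'
      have h0 : 0 ≤ (x - s) ^ (1 - β) := Real.rpow_nonneg (sub_nonneg.2 hs'.2) _
      rw [norm_mul, Complex.norm_real, Real.norm_of_nonneg h0]
      exact mul_le_mul_of_nonneg_left
        (norm_mlTerm_le hβ.1.le (Or.inl rfl) k (Set.Ioo_subset_Icc_self (hIoc s hs))) h0
    · simp only [tsum_mul_left]
      exact hkernel.mul_const _
    · rw [deriv_deriv_u11 hβ.1.le (hIoc s hs)]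
      exact (summable_mlTerm hβ.1.le (Or.inl rfl)
        (Set.Ioo_subset_Icc_self (hIoc s hs))).hasSum.mul_left _
  have hΓ : Complex.Gamma ((2 - β : ℝ) : ℂ) ≠ 0 := by
    rw [Complex.Gamma_ofReal]
    exact_mod_cast (Real.Gamma_pos_of_pos (sub_pos.2 hβ.2)).ne'
  rw [caputoC2, ← hint.tsum_eq, hint.summable.tsum_eq_zero_add]
  simp only [integral_rpow_mul_mlTerm_zero _ hβ hx.1]
  rw [tsum_mul_left, tsum_mul_left, ← u11_eq_tsum_mlTerm hx.1]
  simp only [mlTerm, gammaPow, Nat.cast_zero, zero_mul, add_zero, Real.Gamma_zero, div_zero,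
    Complex.ofReal_zero, mul_zero, intervalIntegral.integral_zero, zero_add]
  field_simp

end series

theorem mlC_zero (a b : ℝ) : mlC a b 0 = (Complex.Gamma (b : ℂ))⁻¹ := by
  rw [mlC, tsum_eq_single 0 fun k hk => by simp [hk]]
  simp

theorem continuousAt_mlC_zero {a b : ℝ} (ha : 1 ≤ a) (hb : 0 ≤ b) : ContinuousAt (mlC a b) 0 := by
  refine ContinuousOn.continuousAt (s := Metric.closedBall 0 1) ?_
    (Metric.closedBall_mem_nhds 0 one_pos)
  refine continuousOn_tsum (fun k => by fun_prop)
    (summable_pow_mul_abs_inv_Gamma ha hb zero_le_one) fun k z hz => ?_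
  rw [mem_closedBall_zero_iff] at hz
  rw [Complex.Gamma_ofReal, div_eq_mul_inv, ← Complex.ofReal_inv, norm_mul, norm_pow,
    Complex.norm_real, Real.norm_eq_abs]
  gcongr

theorem hasDerivAt_u11_zero {β : ℝ} (hβ : 1 ≤ β) (lam : ℂ) : HasDerivAt (u11 β lam) 1 0 := by
  have hβ0 : β ≠ 0 := by linarith
  have hw : ContinuousAt (fun x : ℝ => -lam * ((x ^ β : ℝ) : ℂ)) 0 :=
    continuousAt_const.mul (Complex.continuous_ofReal.continuousAt.comp
      (Real.continuousAt_rpow_const 0 β (Or.inr (by linarith))))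
  have hw0 : -lam * (((0 : ℝ) ^ β : ℝ) : ℂ) = 0 := by simp [Real.zero_rpow hβ0]
  have hlim : Filter.Tendsto (fun x : ℝ => mlC β 2 (-lam * ((x ^ β : ℝ) : ℂ))) (nhds 0)
      (nhds 1) := by
    have h := ContinuousAt.comp (g := mlC β 2) (by
      rw [hw0]; exact continuousAt_mlC_zero hβ zero_le_two) hw
    rw [ContinuousAt, Function.comp_apply, hw0, mlC_zero] at h
    simpa [Function.comp_def] using h
  rw [hasDerivAt_iff_tendsto_slope]
  refine (hlim.mono_left nhdsWithin_le_nhds).congr' ?_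
  filter_upwards [self_mem_nhdsWithin] with x hx
  have hx' : (x : ℂ) ≠ 0 := by exact_mod_cast hx
  simp [slope, u11, hx']

/-- If `E_{β,2}(−λ) = 0` then `u(x) = x E_{β,2}(−λ x^β)` is a nontrivial Dirichlet
eigenfunction of `−D_0^β` on `(0,1)`. -/
theorem stmt_11 (β : ℝ) (hβ : β ∈ Set.Ioo (1:ℝ) 2) (lam : ℂ)
    (hlam : mlC β 2 (-lam) = 0) :
    deriv (u11 β lam) 0 = 1 ∧
    u11 β lam 0 = 0 ∧
    u11 β lam 1 = 0 ∧
    ∀ x ∈ Set.Ioo (0:ℝ) 1, -(caputoC2 β (u11 β lam) x) = lam * u11 β lam x := by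
  refine ⟨(hasDerivAt_u11_zero hβ.1.le lam).deriv, by simp [u11], by simp [u11, hlam], ?_⟩
  intro x hx
  rw [caputoC2_u11 hβ hx, neg_mul, neg_neg]
end

section
/- Let β ∈ (1,2) and let λ ∈ ℂ satisfy E_{β,β}(−λ) = 0. Then u(x) = x^{β−1} E_{β,β}(−λ x^β) is a nontrivial solution of the Riemann–Liouville fractional eigenvalue problem with zero potential: −(ᴿᴸD_0^β u)(x) = λ u(x) on (0,1) together with the homogeneous Dirichlet boundary conditions u(0) = 0 and u(1) = 0, where ᴿᴸD_0^β is the left-sided Riemann–Liouville fractional derivative of order β. -/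
open scoped Real

/-- The eigenfunction of the Riemann–Liouville fractional Sturm-Liouville problem
with zero potential. -/
noncomputable def u12 (β : ℝ) (lam : ℂ) (x : ℝ) : ℂ :=
  ((x ^ (β - 1) : ℝ) : ℂ) * mlC β β (-lam * ((x ^ β : ℝ) : ℂ))

/-- The power series `∑ aᵏ y^(kβ+c) / Γ(kβ+c+1)`, that is `y^c E_{β,c+1}(a y^β)`. -/
noncomputable def mlPower (a : ℂ) (β c y : ℝ) : ℂ :=
  ∑' k : ℕ, a ^ k * ((y ^ (k * β + c) / Real.Gamma (k * β + c + 1) : ℝ) : ℂ)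

theorem summable_pow_div_Gamma {r β c : ℝ} (hr : 0 ≤ r) (hβ : 1 ≤ β) (hc : 0 ≤ c) :
    Summable fun k : ℕ => r ^ k / Real.Gamma (k * β + c) := by
  rw [← summable_nat_add_iff 2]
  have h1 : Summable fun k : ℕ => r ^ (k + 1) / ((k + 1).factorial : ℝ) :=
    (summable_nat_add_iff 1).2 (Real.summable_pow_div_factorial r)
  refine Summable.of_nonneg_of_le (fun k => ?_) (fun k => ?_) (h1.mul_left r)
  · exact div_nonneg (pow_nonneg hr _) (Real.Gamma_nonneg_of_nonneg (by positivity))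
  · have hle : ((k + 1 : ℕ) : ℝ) + 1 ≤ ((k + 2 : ℕ) : ℝ) * β + c := by
      push_cast
      nlinarith [(Nat.cast_nonneg k : (0 : ℝ) ≤ k)]
    have h2 : (2 : ℝ) ≤ ((k + 1 : ℕ) : ℝ) + 1 := by
      push_cast
      linarith [(Nat.cast_nonneg k : (0 : ℝ) ≤ k)]
    have hG := Real.Gamma_strictMonoOn_Ici.monotoneOn h2 (h2.trans hle) hle
    rw [Real.Gamma_nat_eq_factorial] at hG
    rw [← mul_div_assoc, ← pow_succ']
    gcongr

theorem summable_pow_mul_rpow_div_Gamma {r β c y : ℝ} (hr : 0 ≤ r) (hβ : 1 ≤ β)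
    (hc : -1 ≤ c) (hy : 0 < y) :
    Summable fun k : ℕ => r ^ k * (y ^ (k * β + c) / Real.Gamma (k * β + c + 1)) := by
  have h := (summable_pow_div_Gamma (r := r * y ^ β) (by positivity) hβ
    (by linarith : 0 ≤ c + 1)).mul_left (y ^ c)
  refine h.congr fun k => ?_
  rw [Real.rpow_add hy, mul_comm (k : ℝ) β, Real.rpow_mul hy.le, Real.rpow_natCast, mul_pow,
    ← add_assoc]
  ring

theorem Gamma_nonneg_index {β c : ℝ} (hβ : 1 ≤ β) (hc : -1 ≤ c) (k : ℕ) :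
    0 ≤ Real.Gamma (k * β + c + 1) := by
  have : 0 ≤ (k : ℝ) * β := by positivity
  exact Real.Gamma_nonneg_of_nonneg (by linarith)

theorem norm_pow_mul_rpow_div_Gamma {a : ℂ} {β c y : ℝ} (hβ : 1 ≤ β) (hc : -1 ≤ c)
    (hy : 0 ≤ y) (k : ℕ) :
    ‖a ^ k * ((y ^ (k * β + c) / Real.Gamma (k * β + c + 1) : ℝ) : ℂ)‖ =
      ‖a‖ ^ k * (y ^ (k * β + c) / Real.Gamma (k * β + c + 1)) := by
  rw [norm_mul, norm_pow, Complex.norm_real, Real.norm_of_nonneg]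
  exact div_nonneg (Real.rpow_nonneg hy _) (Gamma_nonneg_index hβ hc k)

theorem rpow_le_add_rpow {p q z : ℝ} (r : ℝ) (hp : 0 < p) (hpz : p ≤ z) (hzq : z ≤ q) :
    z ^ r ≤ p ^ r + q ^ r := by
  have hz := hp.trans_le hpz
  rcases le_total 0 r with h | h
  · linarith [Real.rpow_le_rpow hz.le hzq h, Real.rpow_nonneg hp.le r]
  · linarith [Real.rpow_le_rpow_of_nonpos hp hpz h, Real.rpow_nonneg (hz.le.trans hzq) r]

theorem hasDerivAt_rpow_div_Gamma {p y : ℝ} (hy : 0 < y) :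
    HasDerivAt (fun z : ℝ => z ^ p / Real.Gamma (p + 1)) (y ^ (p - 1) / Real.Gamma p) y := by
  have h := (Real.hasDerivAt_rpow_const (p := p) (Or.inl hy.ne')).div_const (Real.Gamma (p + 1))
  have heq : y ^ (p - 1) / Real.Gamma p = p * y ^ (p - 1) / Real.Gamma (p + 1) := by
    rcases eq_or_ne p 0 with rfl | hp
    · simp
    · rw [Real.Gamma_add_one hp, mul_div_mul_left _ _ hp]
  rw [heq]
  exact h

theorem hasDerivAt_mlPower (a : ℂ) {β c y : ℝ} (hβ : 1 ≤ β) (hc : 0 ≤ c) (hy : 0 < y) :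
    HasDerivAt (mlPower a β c) (mlPower a β (c - 1) y) y := by
  have hc' : -1 ≤ c - 1 := by linarith
  have hmem : y ∈ Set.Ioo (y / 2) (2 * y) := ⟨by linarith, by linarith⟩
  refine hasDerivAt_tsum_of_isPreconnected (t := Set.Ioo (y / 2) (2 * y)) (y₀ := y)
    (g := fun (k : ℕ) (z : ℝ) => a ^ k * ((z ^ (k * β + c) / Real.Gamma (k * β + c + 1) : ℝ) : ℂ))
    (g' := fun (k : ℕ) (z : ℝ) =>
      a ^ k * ((z ^ (k * β + (c - 1)) / Real.Gamma (k * β + (c - 1) + 1) : ℝ) : ℂ))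
    ((summable_pow_mul_rpow_div_Gamma (norm_nonneg a) hβ hc' (half_pos hy)).add
      (summable_pow_mul_rpow_div_Gamma (norm_nonneg a) hβ hc' (by linarith : 0 < 2 * y)))
    isOpen_Ioo isPreconnected_Ioo (fun k z hz => ?_) (fun k z hz => ?_) hmem ?_ hmem
  · have h := (hasDerivAt_rpow_div_Gamma (p := k * β + c)
      ((half_pos hy).trans hz.1)).ofReal_comp.const_mul (a ^ k)
    rw [show (k : ℝ) * β + (c - 1) + 1 = k * β + c by ring, ← add_sub_assoc]
    exact h
  · rw [norm_pow_mul_rpow_div_Gamma hβ hc' ((half_pos hy).trans hz.1).le, ← mul_add, ← add_div]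
    have := Gamma_nonneg_index hβ hc' k
    gcongr
    exact rpow_le_add_rpow _ (half_pos hy) hz.1.le hz.2.le
  · refine Summable.of_norm ?_
    simp_rw [norm_pow_mul_rpow_div_Gamma hβ (by linarith : -1 ≤ c) hy.le]
    exact summable_pow_mul_rpow_div_Gamma (norm_nonneg a) hβ (by linarith) hy

theorem integral_sub_rpow_mul_rpow {s t y : ℝ} (hs : 0 < s) (ht : 0 < t) (hy : 0 < y) :
    ∫ x in (0 : ℝ)..y, (y - x) ^ (t - 1) * x ^ (s - 1) =
      y ^ (s + t - 1) * (Real.Gamma s * Real.Gamma t / Real.Gamma (s + t)) := by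
  have hst : Complex.Gamma ((s : ℂ) + t) ≠ 0 :=
    Complex.Gamma_ne_zero_of_re_pos (by simpa using add_pos hs ht)
  have h := Complex.betaIntegral_scaled (s : ℂ) (t : ℂ) hy
  have hB : Complex.betaIntegral s t =
      Complex.Gamma s * Complex.Gamma t / Complex.Gamma ((s : ℂ) + t) := by
    rw [Complex.Gamma_mul_Gamma_eq_betaIntegral (by simpa) (by simpa),
      mul_div_cancel_left₀ _ hst]
  rw [hB] at h
  apply Complex.ofReal_injective
  rw [← intervalIntegral.integral_ofReal]
  push_cast [Complex.ofReal_cpow hy.le, ← Complex.Gamma_ofReal]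
  rw [← h]
  refine intervalIntegral.integral_congr fun x hx => ?_
  rw [Set.uIcc_of_le hy.le] at hx
  push_cast [Complex.ofReal_cpow hx.1, Complex.ofReal_cpow (sub_nonneg.2 hx.2)]
  ring

theorem u12_eq_tsum (β : ℝ) (lam : ℂ) {x : ℝ} (hx : 0 < x) :
    u12 β lam x =
      ∑' k : ℕ, (-lam) ^ k * ((x ^ (k * β + β - 1) / Real.Gamma (k * β + β) : ℝ) : ℂ) := by
  rw [u12, mlC, ← tsum_mul_left]
  refine tsum_congr fun k => ?_
  rw [Complex.Gamma_ofReal, mul_pow, ← Complex.ofReal_pow, ← Real.rpow_natCast (x ^ β),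
    ← Real.rpow_mul hx.le, show (k : ℝ) * β + β - 1 = (β - 1) + β * k by ring,
    Real.rpow_add hx]
  push_cast
  ring

theorem mlPower_neg_one {β : ℝ} (hβ : 1 ≤ β) (lam : ℂ) {x : ℝ} (hx : 0 < x) :
    mlPower (-lam) β (-1) x = -lam * u12 β lam x := by
  have hs : Summable fun k : ℕ =>
      (-lam) ^ k * ((x ^ (k * β + -1) / Real.Gamma (k * β + -1 + 1) : ℝ) : ℂ) := by
    refine Summable.of_norm ?_
    simp_rw [norm_pow_mul_rpow_div_Gamma hβ le_rfl hx.le]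
    exact summable_pow_mul_rpow_div_Gamma (norm_nonneg _) hβ le_rfl hx
  rw [mlPower, hs.tsum_eq_zero_add, u12_eq_tsum β lam hx, ← tsum_mul_left]
  simp only [Nat.cast_zero, zero_mul, zero_add, neg_add_cancel, Real.Gamma_zero, div_zero,
    Complex.ofReal_zero, mul_zero]
  refine tsum_congr fun k => ?_
  rw [pow_succ', mul_assoc, show ((k + 1 : ℕ) : ℝ) * β + -1 + 1 = k * β + β by push_cast; ring,
    show ((k + 1 : ℕ) : ℝ) * β + -1 = k * β + β - 1 by push_cast; ring]

theorem fractional_integral_u12 {β : ℝ} (hβ : β ∈ Set.Ioo (1 : ℝ) 2) (lam : ℂ) {y : ℝ}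
    (hy : 0 < y) :
    (1 / Complex.Gamma ((2 - β : ℝ) : ℂ)) *
      ∫ s in (0 : ℝ)..y, (((y - s) ^ (1 - β) : ℝ) : ℂ) * u12 β lam s =
      mlPower (-lam) β 1 y := by
  have h1 : 1 ≤ β := hβ.1.le
  have hΓ : 0 < Real.Gamma (2 - β) := Real.Gamma_pos_of_pos (by linarith [hβ.2])
  set g : ℕ → ℝ → ℝ := fun k s => (y - s) ^ (1 - β) * s ^ (k * β + β - 1) with hg
  have hpos : ∀ k : ℕ, 0 < (k : ℝ) * β + β := fun k => by positivity
  have hint : ∀ k : ℕ, ∫ s in (0 : ℝ)..y, g k s =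
      y ^ (k * β + 1) * (Real.Gamma (k * β + β) * Real.Gamma (2 - β) /
        Real.Gamma (k * β + 1 + 1)) := fun k => by
    have h := integral_sub_rpow_mul_rpow (hpos k) (by linarith [hβ.2] : 0 < 2 - β) hy
    rw [show 2 - β - 1 = 1 - β by ring, show (k : ℝ) * β + β + (2 - β) = k * β + 1 + 1 by ring,
      show (k : ℝ) * β + 1 + 1 - 1 = k * β + 1 by ring] at h
    exact h
  have hgi : ∀ k, IntervalIntegrable (g k) MeasureTheory.volume 0 y := fun k => by
    refine intervalIntegral.intervalIntegrable_of_integral_ne_zero ?_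
    rw [hint k]
    have := Real.Gamma_pos_of_pos (hpos k)
    have : 0 < Real.Gamma ((k : ℝ) * β + 1 + 1) := Real.Gamma_pos_of_pos (by positivity)
    positivity
  set F : ℕ → ℝ → ℂ := fun k s =>
    (-lam) ^ k / (Real.Gamma (k * β + β) : ℂ) * (g k s : ℂ) with hF
  have hFint : ∀ k, ∫ s in (0 : ℝ)..y, F k s = (Real.Gamma (2 - β) : ℂ) *
      ((-lam) ^ k * ((y ^ (k * β + 1) / Real.Gamma (k * β + 1 + 1) : ℝ) : ℂ)) := fun k => by
    have hne : (Real.Gamma (k * β + β) : ℂ) ≠ 0 :=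
      Complex.ofReal_ne_zero.2 (Real.Gamma_pos_of_pos (hpos k)).ne'
    rw [hF, intervalIntegral.integral_const_mul, intervalIntegral.integral_ofReal, hint k]
    rw [Complex.ofReal_mul, Complex.ofReal_div, Complex.ofReal_div, Complex.ofReal_mul]
    generalize (Real.Gamma (k * β + β) : ℂ) = G at hne ⊢
    field_simp
  have hnorm : ∀ k, ∫ s in (0 : ℝ)..y, ‖F k s‖ = Real.Gamma (2 - β) *
      (‖-lam‖ ^ k * (y ^ (k * β + 1) / Real.Gamma (k * β + 1 + 1))) := fun k => by
    have hp := Real.Gamma_pos_of_pos (hpos k)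
    have : ∫ s in (0 : ℝ)..y, ‖F k s‖ =
        ∫ s in (0 : ℝ)..y, ‖-lam‖ ^ k / Real.Gamma (k * β + β) * g k s := by
      refine intervalIntegral.integral_congr fun s hs => ?_
      rw [Set.uIcc_of_le hy.le] at hs
      have : 0 ≤ g k s :=
        mul_nonneg (Real.rpow_nonneg (sub_nonneg.2 hs.2) _) (Real.rpow_nonneg hs.1 _)
      simp only [hF, norm_mul, norm_div, norm_pow, Complex.norm_real]
      rw [Real.norm_of_nonneg this, Real.norm_of_nonneg hp.le]
    rw [this, intervalIntegral.integral_const_mul, hint k]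
    field_simp
  have hsum := MeasureTheory.hasSum_integral_of_summable_integral_norm
    (μ := MeasureTheory.volume.restrict (Set.Ioc 0 y)) (F := F)
    (fun k => ((hgi k).1.ofReal (𝕜 := ℂ)).const_mul _) (by
      simp_rw [← intervalIntegral.integral_of_le hy.le, hnorm]
      exact (summable_pow_mul_rpow_div_Gamma (norm_nonneg _) h1 (by norm_num) hy).mul_left _)
  simp_rw [← intervalIntegral.integral_of_le hy.le, hFint] at hsum
  have hu : ∫ s in (0 : ℝ)..y, (((y - s) ^ (1 - β) : ℝ) : ℂ) * u12 β lam s =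
      ∫ s in (0 : ℝ)..y, ∑' k, F k s := by
    refine intervalIntegral.integral_congr_ae (Filter.Eventually.of_forall fun s hs => ?_)
    rw [Set.uIoc_of_le hy.le] at hs
    rw [u12_eq_tsum β lam hs.1, ← tsum_mul_left]
    refine tsum_congr fun k => ?_
    simp only [hF, hg]
    push_cast
    ring
  rw [hu, ← hsum.tsum_eq, tsum_mul_left, Complex.Gamma_ofReal, ← mul_assoc,
    one_div_mul_cancel (Complex.ofReal_ne_zero.2 hΓ.ne'), one_mul, mlPower]

theorem rlC2_u12 {β : ℝ} (hβ : β ∈ Set.Ioo (1 : ℝ) 2) (lam : ℂ) {x : ℝ} (hx : 0 < x) :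
    rlC2 β (u12 β lam) x = -lam * u12 β lam x := by
  have h1 : 1 ≤ β := hβ.1.le
  have hfirst : deriv (fun y : ℝ => (1 / Complex.Gamma ((2 - β : ℝ) : ℂ)) *
      ∫ s in (0 : ℝ)..y, (((y - s) ^ (1 - β) : ℝ) : ℂ) * u12 β lam s) =ᶠ[nhds x]
      mlPower (-lam) β 0 := by
    filter_upwards [lt_mem_nhds hx] with z hz
    have heq : (fun y : ℝ => (1 / Complex.Gamma ((2 - β : ℝ) : ℂ)) *
        ∫ s in (0 : ℝ)..y, (((y - s) ^ (1 - β) : ℝ) : ℂ) * u12 β lam s) =ᶠ[nhds z]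
        mlPower (-lam) β 1 := by
      filter_upwards [lt_mem_nhds hz] with y hy using fractional_integral_u12 hβ lam hy
    rw [heq.deriv_eq, (hasDerivAt_mlPower (-lam) h1 zero_le_one hz).deriv, sub_self]
  rw [rlC2, hfirst.deriv_eq, (hasDerivAt_mlPower (-lam) h1 le_rfl hx).deriv, zero_sub,
    mlPower_neg_one h1 lam hx]

theorem tendsto_mlC_nhds_zero {β : ℝ} (hβ : 1 ≤ β) :
    Filter.Tendsto (mlC β β) (nhds 0) (nhds (mlC β β 0)) := by
  refine tendsto_tsum_of_dominated_convergence
    (summable_pow_div_Gamma zero_le_one hβ (zero_le_one.trans hβ)) (fun k => ?_) ?_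
  · exact ((continuous_pow k).div_const _).tendsto 0
  · filter_upwards [Metric.ball_mem_nhds (0 : ℂ) one_pos] with z hz k
    have hz' : ‖z‖ ≤ 1 := by simpa using (mem_ball_zero_iff.1 hz).le
    have hG : 0 ≤ Real.Gamma (k * β + β) := Real.Gamma_nonneg_of_nonneg (by positivity)
    rw [norm_div, norm_pow, Complex.Gamma_ofReal, Complex.norm_real, Real.norm_of_nonneg hG]
    gcongr

theorem exists_u12_ne_zero {β : ℝ} (hβ : 1 ≤ β) (lam : ℂ) :
    ∃ x ∈ Set.Ioo (0 : ℝ) 1, u12 β lam x ≠ 0 := by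
  have hβ0 : 0 < β := zero_lt_one.trans_le hβ
  have h0 : mlC β β 0 ≠ 0 := by
    rw [mlC, tsum_eq_single 0 fun k hk => by simp [hk]]
    simpa [Complex.Gamma_ofReal] using (Real.Gamma_pos_of_pos hβ0).ne'
  have hinner : Filter.Tendsto (fun x : ℝ => -lam * ((x ^ β : ℝ) : ℂ)) (nhds 0) (nhds 0) := by
    have : Continuous fun x : ℝ => -lam * ((x ^ β : ℝ) : ℂ) :=
      continuous_const.mul (Complex.continuous_ofReal.comp (Real.continuous_rpow_const hβ0.le))
    simpa [Real.zero_rpow hβ0.ne'] using this.tendsto 0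
  have hne := ((tendsto_mlC_nhds_zero hβ).comp hinner).eventually_ne h0
  obtain ⟨x, hx, hx'⟩ := ((hne.filter_mono nhdsWithin_le_nhds).and
    (Ioo_mem_nhdsGT (zero_lt_one : (0 : ℝ) < 1))).exists
  refine ⟨x, hx', mul_ne_zero ?_ hx⟩
  exact Complex.ofReal_ne_zero.2 (Real.rpow_pos_of_pos hx'.1 _).ne'

/-- If `E_{β,β}(−λ) = 0` then `u(x) = x^{β−1} E_{β,β}(−λ x^β)` is a nontrivial Dirichlet
eigenfunction of the Riemann–Liouville operator `−ᴿᴸD_0^β` on `(0,1)`. -/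
theorem stmt_12 (β : ℝ) (hβ : β ∈ Set.Ioo (1:ℝ) 2) (lam : ℂ)
    (hlam : mlC β β (-lam) = 0) :
    (∃ x ∈ Set.Ioo (0:ℝ) 1, u12 β lam x ≠ 0) ∧
    u12 β lam 0 = 0 ∧
    u12 β lam 1 = 0 ∧
    ∀ x ∈ Set.Ioo (0:ℝ) 1, -(rlC2 β (u12 β lam) x) = lam * u12 β lam x := by
  refine ⟨exists_u12_ne_zero hβ.1.le lam, ?_, ?_, fun x hx => ?_⟩
  · rw [u12, Real.zero_rpow (by linarith [hβ.1]), Complex.ofReal_zero, zero_mul]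
  · simp [u12, hlam]
  · rw [rlC2_u12 hβ lam hx.1]
    ring
end
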